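/- arXiv:2210.08446 — 2 statements merged into one kernel-verified Lean document; each statement's English description precedes it below -/
import Mathlib

section
/- For real numbers σ ≥ λ > 0 and real s, the integral ∫_{-π}^{π} (cos²θ/σ² + sin²θ/λ²)^s dθ equals (2πλ/σ^{1+2s}) · ₂F₁(1/2, 1+s; 1; 1 - λ²/σ²). -/
open Real MeasureTheory intervalIntegral

/-- Gauss hypergeometric series `₂F₁(a,b;c;z)` over the reals. -/
noncomputable def hyp2F1 (a b c z : ℝ) : ℝ :=
  ∑' n : ℕ, ((ascPochhammer ℝ n).eval a * (ascPochhammer ℝ n).eval b /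
      ((ascPochhammer ℝ n).eval c * (n.factorial : ℝ))) * z ^ n

/-- The binomial series `∑ (a)ₙ / n! xⁿ = (1 - x)⁻ᵃ`. -/
theorem hasSum_ascPochhammer_mul_pow (a : ℝ) {x : ℝ} (hx : |x| < 1) :
    HasSum (fun n : ℕ => (ascPochhammer ℝ n).eval a / (n.factorial : ℝ) * x ^ n)
      ((1 - x) ^ (-a)) := by
  have h := (Real.one_div_one_sub_rpow_hasFPowerSeriesOnBall_zero a).hasSum
    (y := x) (by simpa [enorm_eq_nnnorm, ← NNReal.coe_lt_coe] using hx)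
  have h0 : 0 ≤ 1 - x := by linarith [(abs_lt.mp hx).2]
  rw [zero_add, one_div, ← Real.rpow_neg h0] at h
  convert! h using 2 with n
  have hf : (n.factorial : ℝ) ≠ 0 := by positivity
  have hm := Ring.factorial_nsmul_multichoose_eq_ascPochhammer a n
  rw [Polynomial.ascPochhammer_smeval_eq_eval, nsmul_eq_mul, Ring.multichoose_eq] at hm
  rw [← hm, mul_div_cancel_left₀ _ hf]
  simp [FormalMultilinearSeries.ofScalars, mul_comm]

theorem prod_range_odd_div_even_eq_ascPochhammer (n : ℕ) :
    ∏ i ∈ Finset.range n, (2 * (i : ℝ) + 1) / (2 * i + 2) =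
      (ascPochhammer ℝ n).eval (1 / 2) / (n.factorial : ℝ) := by
  induction n with
  | zero => simp
  | succ n ih =>
    have hf : (n.factorial : ℝ) ≠ 0 := by positivity
    have hn : (n : ℝ) + 1 ≠ 0 := by positivity
    rw [Finset.prod_range_succ, ih, ascPochhammer_succ_eval, Nat.factorial_succ]
    push_cast
    field_simp
    ring

theorem integral_sin_pow_even_neg_pi_pi (n : ℕ) :
    ∫ θ in (-π)..π, Real.sin θ ^ (2 * n) =
      2 * π * ((ascPochhammer ℝ n).eval (1 / 2) / (n.factorial : ℝ)) := by
  have hint (a b : ℝ) : IntervalIntegrable (fun θ => Real.sin θ ^ (2 * n)) volume a b :=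
    (by fun_prop : Continuous fun θ => Real.sin θ ^ (2 * n)).intervalIntegrable a b
  have hneg : ∫ θ in (-π)..0, Real.sin θ ^ (2 * n) = ∫ θ in (0)..π, Real.sin θ ^ (2 * n) := by
    have h := integral_comp_neg (a := 0) (b := π) fun θ => Real.sin θ ^ (2 * n)
    simpa [pow_mul] using h.symm
  rw [← integral_add_adjacent_intervals (hint (-π) 0) (hint 0 π), hneg, integral_sin_pow_even,
    prod_range_odd_div_even_eq_ascPochhammer]
  ring

/-- Termwise integration of the binomial series. -/
theorem integral_one_sub_mul_sin_sq_rpow_neg (b : ℝ) {z : ℝ} (hz0 : 0 ≤ z) (hz1 : z < 1) :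
    ∫ θ in (-π)..π, (1 - z * Real.sin θ ^ 2) ^ (-b) = 2 * π * hyp2F1 (1 / 2) b 1 z := by
  have hbd (θ : ℝ) : |z * Real.sin θ ^ 2| ≤ z := by
    rw [abs_of_nonneg (by positivity)]
    exact mul_le_of_le_one_right hz0 (Real.sin_sq_le_one θ)
  have hsum := (hasSum_ascPochhammer_mul_pow b (by rwa [abs_of_nonneg hz0])).summable.abs
  have key := hasSum_integral_of_dominated_convergence (μ := volume) (a := -π) (b := π)
    (F := fun (n : ℕ) θ =>
      (ascPochhammer ℝ n).eval b / (n.factorial : ℝ) * (z * Real.sin θ ^ 2) ^ n)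
    (f := fun θ => (1 - z * Real.sin θ ^ 2) ^ (-b))
    (fun n _ => |(ascPochhammer ℝ n).eval b / (n.factorial : ℝ) * z ^ n|)
    (fun n => (by fun_prop : Continuous _).aestronglyMeasurable)
    (fun n => .of_forall fun θ _ => by
      rw [Real.norm_eq_abs, abs_mul, abs_mul, abs_pow, abs_pow, abs_of_nonneg hz0]
      gcongr
      exact hbd θ)
    (.of_forall fun _ _ => hsum) intervalIntegrable_const
    (.of_forall fun θ _ => hasSum_ascPochhammer_mul_pow b ((hbd θ).trans_lt hz1))
  rw [← key.tsum_eq, hyp2F1, ← tsum_mul_left]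
  refine tsum_congr fun n => ?_
  simp only [mul_pow, ← mul_assoc, ← pow_mul]
  rw [intervalIntegral.integral_const_mul, integral_sin_pow_even_neg_pi_pi, ascPochhammer_eval_one]
  have hf : (n.factorial : ℝ) ≠ 0 := by positivity
  field_simp

/-- The smooth branch of `arctan (k * tan θ)` fixing the multiples of `π`. -/
noncomputable def arctanMulTan (k θ : ℝ) : ℝ :=
  θ + Real.arctan ((k - 1) * (Real.sin θ * Real.cos θ) / (Real.cos θ ^ 2 + k * Real.sin θ ^ 2))

theorem cos_sq_add_mul_sin_sq_pos {k : ℝ} (hk : 0 < k) (θ : ℝ) :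
    0 < Real.cos θ ^ 2 + k * Real.sin θ ^ 2 := by
  by_cases h : Real.sin θ = 0
  · have := Real.sin_sq_add_cos_sq θ
    rw [h] at this ⊢
    linarith
  · positivity

theorem hasDerivAt_arctanMulTan {k : ℝ} (hk : 0 < k) (θ : ℝ) :
    HasDerivAt (arctanMulTan k) (k / (Real.cos θ ^ 2 + k ^ 2 * Real.sin θ ^ 2)) θ := by
  have hD := (cos_sq_add_mul_sin_sq_pos hk θ).ne'
  have hE := (cos_sq_add_mul_sin_sq_pos (pow_pos hk 2) θ).ne'
  have hs := Real.hasDerivAt_sin θ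
  have hc := Real.hasDerivAt_cos θ
  have h := (hasDerivAt_id θ).add
    ((((hs.mul hc).const_mul (k - 1)).div ((hc.pow 2).add ((hs.pow 2).const_mul k)) hD).arctan)
  refine h.congr_deriv ?_
  have hsc := Real.sin_sq_add_cos_sq θ
  simp only [Pi.mul_apply, Pi.add_apply, Pi.pow_apply, Pi.div_apply]
  generalize Real.sin θ = s at *
  generalize Real.cos θ = c at *
  have h1 : 1 + ((k - 1) * (s * c) / (c ^ 2 + k * s ^ 2)) ^ 2 =
      (c ^ 2 + k ^ 2 * s ^ 2) / (c ^ 2 + k * s ^ 2) ^ 2 := by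
    field_simp
    linear_combination (c ^ 2 + k ^ 2 * s ^ 2) * hsc
  rw [h1]
  field_simp
  simp only [Nat.cast_ofNat, Nat.add_one_sub_one, pow_one]
  linear_combination ((k - 1) * (c ^ 2 - k * s ^ 2) + k) * hsc

theorem sin_arctanMulTan_sq {k : ℝ} (hk : 0 < k) (θ : ℝ) :
    Real.sin (arctanMulTan k θ) ^ 2 =
      k ^ 2 * Real.sin θ ^ 2 / (Real.cos θ ^ 2 + k ^ 2 * Real.sin θ ^ 2) := by
  have hD := (cos_sq_add_mul_sin_sq_pos hk θ).ne'
  have hE := (cos_sq_add_mul_sin_sq_pos (pow_pos hk 2) θ).ne'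
  have hsc := Real.sin_sq_add_cos_sq θ
  rw [arctanMulTan, Real.sin_add]
  set x := (k - 1) * (Real.sin θ * Real.cos θ) / (Real.cos θ ^ 2 + k * Real.sin θ ^ 2) with hx
  have hsx : Real.sin (Real.arctan x) = x * Real.cos (Real.arctan x) := by
    rw [← Real.tan_mul_cos (Real.cos_arctan_pos x).ne', Real.tan_arctan]
  have h1 : 1 + x ^ 2 = (Real.cos θ ^ 2 + k ^ 2 * Real.sin θ ^ 2) /
      (Real.cos θ ^ 2 + k * Real.sin θ ^ 2) ^ 2 := by
    rw [hx]
    field_simp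
    linear_combination (Real.cos θ ^ 2 + k ^ 2 * Real.sin θ ^ 2) * hsc
  have h2 : Real.sin θ + Real.cos θ * x =
      k * Real.sin θ / (Real.cos θ ^ 2 + k * Real.sin θ ^ 2) := by
    have hxD := div_mul_cancel₀ ((k - 1) * (Real.sin θ * Real.cos θ)) hD
    rw [← hx] at hxD
    rw [eq_div_iff hD]
    linear_combination Real.cos θ * hxD + k * Real.sin θ * hsc
  calc _ = (Real.sin θ + Real.cos θ * x) ^ 2 * Real.cos (Real.arctan x) ^ 2 := by rw [hsx]; ring
    _ = _ := by
      rw [Real.cos_sq_arctan, h1, h2]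
      field_simp

theorem integral_theorem1 (σ lam s : ℝ) (h1 : lam ≤ σ) (h2 : 0 < lam) :
    ∫ θ in (-π)..π, (Real.cos θ ^ 2 / σ ^ 2 + Real.sin θ ^ 2 / lam ^ 2) ^ s =
      (2 * π * lam / σ ^ (1 + 2 * s)) * hyp2F1 (1/2) (1 + s) 1 (1 - lam ^ 2 / σ ^ 2) := by
  have hσ : 0 < σ := h2.trans_le h1
  have hk : 0 < σ / lam := div_pos hσ h2
  have hz0 : 0 ≤ 1 - lam ^ 2 / σ ^ 2 := by
    rw [sub_nonneg, div_le_one (by positivity)]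
    gcongr
  have hz1 : 1 - lam ^ 2 / σ ^ 2 < 1 := sub_lt_self _ (by positivity)
  have hpos (θ : ℝ) : 0 < 1 - (1 - lam ^ 2 / σ ^ 2) * Real.sin θ ^ 2 := by
    nlinarith [Real.sin_sq_le_one θ, sq_nonneg (Real.sin θ)]
  have hE (θ : ℝ) := cos_sq_add_mul_sin_sq_pos (pow_pos hk 2) θ
  have hg : Continuous fun φ : ℝ =>
      (1 - (1 - lam ^ 2 / σ ^ 2) * Real.sin φ ^ 2) ^ (-(1 + s)) :=
    Continuous.rpow_const (by fun_prop) fun φ => .inl (hpos φ).ne'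
  have hsubst := integral_comp_mul_deriv (a := -π) (b := π)
    (fun θ _ => hasDerivAt_arctanMulTan hk θ)
    (Continuous.continuousOn (Continuous.div (by fun_prop) (by fun_prop) fun θ => (hE θ).ne')) hg
  have hends : arctanMulTan (σ / lam) (-π) = -π ∧ arctanMulTan (σ / lam) π = π := by
    simp [arctanMulTan]
  rw [hends.1, hends.2, integral_one_sub_mul_sin_sq_rpow_neg _ hz0 hz1] at hsubst
  have hrpow : σ ^ (1 + 2 * s) = σ * (σ ^ 2) ^ s := by
    rw [Real.rpow_add hσ, Real.rpow_one, Real.rpow_mul hσ.le, Real.rpow_two]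
  have hpoint (θ : ℝ) : ((fun φ => (1 - (1 - lam ^ 2 / σ ^ 2) * Real.sin φ ^ 2) ^ (-(1 + s))) ∘
      arctanMulTan (σ / lam)) θ *
        (σ / lam / (Real.cos θ ^ 2 + (σ / lam) ^ 2 * Real.sin θ ^ 2)) =
      (σ ^ (1 + 2 * s) / lam) *
        (Real.cos θ ^ 2 / σ ^ 2 + Real.sin θ ^ 2 / lam ^ 2) ^ s := by
    have hEθ := hE θ
    have hbase : 1 - (1 - lam ^ 2 / σ ^ 2) * Real.sin (arctanMulTan (σ / lam) θ) ^ 2 =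
        (Real.cos θ ^ 2 + (σ / lam) ^ 2 * Real.sin θ ^ 2)⁻¹ := by
      have hsc := Real.sin_sq_add_cos_sq θ
      have hcancel : (1 - lam ^ 2 / σ ^ 2) * (σ / lam) ^ 2 = (σ / lam) ^ 2 - 1 := by
        field_simp
      rw [sin_arctanMulTan_sq hk, mul_div_assoc', ← mul_assoc, hcancel,
        inv_eq_one_div, eq_div_iff hEθ.ne', sub_mul, div_mul_cancel₀ _ hEθ.ne']
      linear_combination hsc
    have hfactor : Real.cos θ ^ 2 / σ ^ 2 + Real.sin θ ^ 2 / lam ^ 2 =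
        (Real.cos θ ^ 2 + (σ / lam) ^ 2 * Real.sin θ ^ 2) / σ ^ 2 := by
      field_simp
    rw [Function.comp_apply, hbase, hfactor, hrpow, Real.div_rpow hEθ.le (by positivity),
      Real.inv_rpow hEθ.le, Real.rpow_neg hEθ.le, inv_inv, Real.rpow_add hEθ, Real.rpow_one]
    have hσs : (σ ^ 2) ^ s ≠ 0 := by positivity
    generalize Real.cos θ ^ 2 + (σ / lam) ^ 2 * Real.sin θ ^ 2 = E at hEθ ⊢
    field_simp
  simp only [hpoint] at hsubst
  rw [intervalIntegral.integral_const_mul] at hsubst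
  have hσr : σ ^ (1 + 2 * s) ≠ 0 := by positivity
  field_simp at hsubst ⊢
  linear_combination hsubst
end

section
/- If Re(γ - α - β) > 0 and γ is not a nonpositive integer, then ₂F₁(α, β; γ; 1) = Γ(γ)Γ(γ-α-β) / (Γ(γ-α)Γ(γ-β)). -/
open Complex

/-- Gauss hypergeometric series `₂F₁(a,b;c;z)` over the complex numbers. -/
noncomputable def hyp2F1C (a b c z : ℂ) : ℂ :=
  ∑' n : ℕ, ((ascPochhammer ℂ n).eval a * (ascPochhammer ℂ n).eval b /
      ((ascPochhammer ℂ n).eval c * (n.factorial : ℂ))) * z ^ n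

open Filter Topology

/-- The `n`-th coefficient of the Gauss hypergeometric series `₂F₁(a,b;c;z)`. -/
noncomputable def hyp2F1Coeff (a b c : ℂ) (n : ℕ) : ℂ :=
  (ascPochhammer ℂ n).eval a * (ascPochhammer ℂ n).eval b /
    ((ascPochhammer ℂ n).eval c * (n.factorial : ℂ))

theorem hyp2F1C_one (a b c : ℂ) : hyp2F1C a b c 1 = ∑' n, hyp2F1Coeff a b c n := by
  simp [hyp2F1C, hyp2F1Coeff]

theorem eval_ascPochhammer_eq_prod (n : ℕ) (s : ℂ) :
    (ascPochhammer ℂ n).eval s = ∏ j ∈ Finset.range n, (s + j) := by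
  induction n with
  | zero => simp
  | succ n ih => rw [ascPochhammer_succ_eval, Finset.prod_range_succ, ih]

theorem eval_ascPochhammer_ne_zero {c : ℂ} (hc : ∀ n : ℕ, c ≠ -(n : ℂ)) (n : ℕ) :
    (ascPochhammer ℂ n).eval c ≠ 0 := by
  rw [Ne, ascPochhammer_eval_eq_zero_iff]
  rintro ⟨k, -, hk⟩
  exact hc k (by rw [hk, neg_neg])

theorem eval_ascPochhammer_succ_eq_GammaSeq (s : ℂ) {n : ℕ} (hn : n ≠ 0) :
    (ascPochhammer ℂ (n + 1)).eval s = (n : ℂ) ^ s * n.factorial * (GammaSeq s n)⁻¹ := by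
  have h1 : (n : ℂ) ^ s ≠ 0 := by simp [cpow_eq_zero_iff, hn]
  have h2 : (n.factorial : ℂ) ≠ 0 := by exact_mod_cast n.factorial_ne_zero
  rw [eval_ascPochhammer_eq_prod, GammaSeq, inv_div]
  field_simp

theorem tendsto_inv_GammaSeq (s : ℂ) :
    Tendsto (fun n => (GammaSeq s n)⁻¹) atTop (𝓝 (Gamma s)⁻¹) := by
  by_cases hs : Gamma s = 0
  · obtain ⟨m, rfl⟩ := (Gamma_eq_zero_iff s).1 hs
    rw [hs, inv_zero]
    refine tendsto_const_nhds.congr' ?_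
    filter_upwards [eventually_ge_atTop m] with n hn
    have : ∏ j ∈ Finset.range (n + 1), (-(m : ℂ) + j) = 0 :=
      Finset.prod_eq_zero (i := m) (by simp; omega) (by simp)
    simp [GammaSeq, this]
  · exact (GammaSeq_tendsto_Gamma s).inv₀ hs

theorem hyp2F1Coeff_succ {c : ℂ} (hc : ∀ n : ℕ, c ≠ -(n : ℂ)) (a b : ℂ) (n : ℕ) :
    hyp2F1Coeff a b c (n + 1) * ((n + 1) * (c + n)) =
      hyp2F1Coeff a b c n * ((a + n) * (b + n)) := by
  have h1 := eval_ascPochhammer_ne_zero hc n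
  have h2 : c + n ≠ 0 := fun h => hc n (eq_neg_of_add_eq_zero_left h)
  have h3 : (n.factorial : ℂ) ≠ 0 := by exact_mod_cast n.factorial_ne_zero
  have h4 : (n : ℂ) + 1 ≠ 0 := by exact_mod_cast n.succ_ne_zero
  simp only [hyp2F1Coeff, ascPochhammer_succ_eval, Nat.factorial_succ]
  push_cast
  field_simp

theorem eval_ascPochhammer_add_one (c : ℂ) (n : ℕ) :
    (ascPochhammer ℂ n).eval (c + 1) * c = (ascPochhammer ℂ n).eval c * (c + n) := by
  rw [← ascPochhammer_succ_eval, ascPochhammer_succ_left]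
  simp [mul_comm]

theorem hyp2F1Coeff_add_one {c : ℂ} (hc : ∀ n : ℕ, c ≠ -(n : ℂ)) (a b : ℂ) (n : ℕ) :
    hyp2F1Coeff a b (c + 1) n * (c + n) = hyp2F1Coeff a b c n * c := by
  have h0 : c ≠ 0 := by simpa using hc 0
  have h1 := eval_ascPochhammer_ne_zero hc n
  have h2 : c + n ≠ 0 := fun h => hc n (eq_neg_of_add_eq_zero_left h)
  have h3 : (n.factorial : ℂ) ≠ 0 := by exact_mod_cast n.factorial_ne_zero
  have h4 := eval_ascPochhammer_add_one c n
  have h5 : (ascPochhammer ℂ n).eval (c + 1) ≠ 0 :=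
    left_ne_zero_of_mul (h4 ▸ mul_ne_zero h1 h2)
  simp only [hyp2F1Coeff]
  field_simp
  linear_combination (-(ascPochhammer ℂ n).eval a * (ascPochhammer ℂ n).eval b) * h4

theorem hyp2F1Coeff_succ_eq_GammaSeq (a b c : ℂ) {n : ℕ} (hn : n ≠ 0) :
    hyp2F1Coeff a b c (n + 1) * (n + 1) =
      (GammaSeq a n)⁻¹ * (GammaSeq b n)⁻¹ * GammaSeq c n * (n : ℂ) ^ (a + b - c) := by
  have hn' : (n : ℂ) ≠ 0 := by exact_mod_cast hn
  have h1 : (n : ℂ) ^ c ≠ 0 := by simp [cpow_eq_zero_iff, hn]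
  have h3 : (n.factorial : ℂ) ≠ 0 := by exact_mod_cast n.factorial_ne_zero
  have h4 : (n : ℂ) + 1 ≠ 0 := by exact_mod_cast n.succ_ne_zero
  rw [hyp2F1Coeff, eval_ascPochhammer_succ_eq_GammaSeq a hn,
    eval_ascPochhammer_succ_eq_GammaSeq b hn, eval_ascPochhammer_succ_eq_GammaSeq c hn,
    Nat.factorial_succ, cpow_sub _ _ hn', cpow_add _ _ hn']
  push_cast
  simp only [div_eq_mul_inv, mul_inv, inv_inv]
  field_simp

theorem isBigO_hyp2F1Coeff_succ (a b c : ℂ) :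
    (fun n : ℕ => hyp2F1Coeff a b c (n + 1) * (n + 1)) =O[atTop]
      fun n : ℕ => (n : ℝ) ^ (a + b - c).re := by
  have h := (((tendsto_inv_GammaSeq a).mul (tendsto_inv_GammaSeq b)).mul
    (GammaSeq_tendsto_Gamma c)).isBigO_one ℝ
  have h' : (fun n : ℕ => (n : ℂ) ^ (a + b - c)) =O[atTop]
      fun n : ℕ => (n : ℝ) ^ (a + b - c).re := by
    refine Asymptotics.IsBigO.of_bound 1 ?_
    filter_upwards [eventually_gt_atTop 0] with n hn
    rw [norm_natCast_cpow_of_pos hn, one_mul]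
    exact le_abs_self _
  refine (h.mul h').congr' ?_ (by simp)
  filter_upwards [eventually_ne_atTop 0] with n hn
  exact (hyp2F1Coeff_succ_eq_GammaSeq a b c hn).symm

theorem tendsto_natCast_mul_hyp2F1Coeff {a b c : ℂ} (h : 0 < (c - a - b).re) :
    Tendsto (fun n : ℕ => n * hyp2F1Coeff a b c n) atTop (𝓝 0) := by
  rw [← tendsto_add_atTop_iff_nat 1]
  have h0 : Tendsto (fun n : ℕ => (n : ℝ) ^ (a + b - c).re) atTop (𝓝 0) := by
    have := (tendsto_rpow_neg_atTop h).comp tendsto_natCast_atTop_atTop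
    refine this.congr fun n => ?_
    simp only [Function.comp]
    congr 1
    simp
    ring
  refine ((isBigO_hyp2F1Coeff_succ a b c).trans_tendsto h0).congr fun n => ?_
  push_cast
  ring

theorem summable_hyp2F1Coeff {a b c : ℂ} (h : 0 < (c - a - b).re) :
    Summable (hyp2F1Coeff a b c) := by
  rw [← summable_nat_add_iff 1]
  have hp : (a + b - c).re - 1 < -1 := by
    simp only [sub_re, add_re] at h ⊢
    linarith
  refine summable_of_isBigO_nat (Real.summable_nat_rpow.2 hp) ?_
  have h' : (fun n : ℕ => ((n : ℂ) + 1)⁻¹) =O[atTop] fun n : ℕ => (n : ℝ)⁻¹ := by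
    refine Asymptotics.IsBigO.of_bound 1 ?_
    filter_upwards [eventually_gt_atTop 0] with n hn
    rw [norm_inv, norm_inv, one_mul, show ((n : ℂ) + 1) = ((n + 1 : ℕ) : ℂ) by simp, norm_natCast,
      Real.norm_natCast]
    have : (0 : ℝ) < n := by exact_mod_cast hn
    gcongr
    simp
  refine ((isBigO_hyp2F1Coeff_succ a b c).mul h').congr' ?_ ?_
  · refine Eventually.of_forall fun n => ?_
    have h4 : (n : ℂ) + 1 ≠ 0 := by exact_mod_cast n.succ_ne_zero
    field_simp
  · filter_upwards [eventually_gt_atTop 0] with n hn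
    have : (0 : ℝ) < n := by exact_mod_cast hn
    rw [Real.rpow_sub_one this.ne', div_eq_mul_inv]

theorem hyp2F1C_one_contiguous {a b c : ℂ} (h : 0 < (c - a - b).re)
    (hc : ∀ n : ℕ, c ≠ -(n : ℂ)) :
    c * (c - a - b) * hyp2F1C a b c 1 = (c - a) * (c - b) * hyp2F1C a b (c + 1) 1 := by
  have h' : 0 < (c + 1 - a - b).re := by
    simp only [sub_re, add_re, one_re] at h ⊢
    linarith
  have hs := ((summable_hyp2F1Coeff h).hasSum.mul_left (c * (c - a - b))).sub
    ((summable_hyp2F1Coeff h').hasSum.mul_left ((c - a) * (c - b)))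
  have key (n : ℕ) : c * (c - a - b) * hyp2F1Coeff a b c n -
      (c - a) * (c - b) * hyp2F1Coeff a b (c + 1) n =
      c * (n * hyp2F1Coeff a b c n) - c * ((n + 1 : ℕ) * hyp2F1Coeff a b c (n + 1)) := by
    have h2 : c + n ≠ 0 := fun h => hc n (eq_neg_of_add_eq_zero_left h)
    refine mul_right_cancel₀ h2 ?_
    push_cast
    linear_combination c * hyp2F1Coeff_succ hc a b n -
      (c - a) * (c - b) * hyp2F1Coeff_add_one hc a b n
  have ht := hs.tendsto_sum_nat
  simp only [key, Finset.sum_range_sub'] at ht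
  have ht' := ((tendsto_natCast_mul_hyp2F1Coeff h).const_mul c).const_sub
    (c * ((0 : ℕ) * hyp2F1Coeff a b c 0))
  have := tendsto_nhds_unique ht ht'
  rw [hyp2F1C_one, hyp2F1C_one]
  simpa [sub_eq_zero] using this

theorem add_natCast_ne_neg_natCast {c : ℂ} (hc : ∀ n : ℕ, c ≠ -(n : ℂ)) (m n : ℕ) :
    c + m ≠ -(n : ℂ) := fun h => hc (m + n) (by push_cast; linear_combination h)

theorem hyp2F1C_one_mul_ascPochhammer {a b c : ℂ} (h : 0 < (c - a - b).re)
    (hc : ∀ n : ℕ, c ≠ -(n : ℂ)) (n : ℕ) :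
    (ascPochhammer ℂ n).eval c * (ascPochhammer ℂ n).eval (c - a - b) * hyp2F1C a b c 1 =
      (ascPochhammer ℂ n).eval (c - a) * (ascPochhammer ℂ n).eval (c - b) *
        hyp2F1C a b (c + n) 1 := by
  induction n with
  | zero => simp
  | succ n ih =>
    have hn : 0 < (c + n - a - b).re := by
      simp only [sub_re, add_re, natCast_re] at h ⊢
      linarith [(Nat.cast_nonneg n : (0 : ℝ) ≤ n)]
    have := hyp2F1C_one_contiguous hn (add_natCast_ne_neg_natCast hc n)
    simp only [ascPochhammer_succ_eval]
    push_cast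
    rw [← add_assoc]
    linear_combination (c + n) * (c - a - b + n) * ih + (ascPochhammer ℂ n).eval (c - a) *
      (ascPochhammer ℂ n).eval (c - b) * this

theorem norm_eval_ascPochhammer_le (a : ℂ) (n : ℕ) :
    ‖(ascPochhammer ℂ n).eval a‖ ≤ ‖(ascPochhammer ℂ n).eval (‖a‖ : ℂ)‖ := by
  simp only [eval_ascPochhammer_eq_prod, norm_prod]
  gcongr with j
  calc ‖a + j‖ ≤ ‖a‖ + ‖(j : ℂ)‖ := norm_add_le _ _
    _ = ‖((‖a‖ + j : ℝ) : ℂ)‖ := by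
      rw [norm_natCast, norm_real, Real.norm_of_nonneg (by positivity)]
    _ = _ := by push_cast; rfl

theorem norm_eval_ascPochhammer_ge {c : ℂ} {r : ℝ} (hr : 0 ≤ r) (hc : r ≤ c.re) (n : ℕ) :
    ‖(ascPochhammer ℂ n).eval (r : ℂ)‖ ≤ ‖(ascPochhammer ℂ n).eval c‖ := by
  simp only [eval_ascPochhammer_eq_prod, norm_prod]
  gcongr with j
  calc ‖(r : ℂ) + j‖ = ‖((r + j : ℝ) : ℂ)‖ := by push_cast; rfl
    _ = r + j := by rw [norm_real, Real.norm_of_nonneg (by positivity)]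
    _ ≤ (c + j).re := by simpa using hc
    _ ≤ _ := re_le_norm _

theorem norm_hyp2F1Coeff_le {a b c : ℂ} {r : ℝ} (hr : 0 < r) (hc : r ≤ c.re) (n : ℕ) :
    ‖hyp2F1Coeff a b c n‖ ≤ ‖hyp2F1Coeff ‖a‖ ‖b‖ r n‖ := by
  have hr' : 0 < ‖(ascPochhammer ℂ n).eval (r : ℂ)‖ := by
    refine norm_pos_iff.2 (eval_ascPochhammer_ne_zero (fun m hm => ?_) n)
    have := congrArg re hm
    simp at this
    linarith [(Nat.cast_nonneg m : (0 : ℝ) ≤ m)]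
  have hf : 0 < ‖(n.factorial : ℂ)‖ := by
    rw [norm_natCast]
    exact_mod_cast n.factorial_pos
  simp only [hyp2F1Coeff, norm_div, norm_mul]
  gcongr
  · exact norm_eval_ascPochhammer_le a n
  · exact norm_eval_ascPochhammer_le b n
  · exact norm_eval_ascPochhammer_ge hr.le hc n

theorem tendsto_inv_eval_ascPochhammer_add_natCast (c : ℂ) (k : ℕ) :
    Tendsto (fun n : ℕ => ((ascPochhammer ℂ k).eval (c + n))⁻¹) atTop
      (𝓝 (if k = 0 then 1 else 0)) := by
  induction k with
  | zero => simp
  | succ k ih =>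
    have h : Tendsto (fun n : ℕ => (c + n + k)⁻¹) atTop (𝓝 0) := by
      refine tendsto_inv₀_cobounded.comp ?_
      have := tendsto_add_const_cobounded (c + k) |>.comp
        (tendsto_natCast_atTop_cobounded (α := ℂ))
      refine this.congr fun n => ?_
      simp only [Function.comp]
      ring
    simpa [ascPochhammer_succ_eval, mul_comm] using ih.mul h

theorem tendsto_hyp2F1C_one_add_natCast (a b c : ℂ) :
    Tendsto (fun n : ℕ => hyp2F1C a b (c + n) 1) atTop (𝓝 1) := by
  simp only [hyp2F1C_one]
  set r : ℝ := ‖a‖ + ‖b‖ + 1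
  have hr : 0 < r := by positivity
  have hs : Summable fun k => ‖hyp2F1Coeff ‖a‖ ‖b‖ r k‖ :=
    (summable_hyp2F1Coeff (by simp [r, add_assoc])).norm
  rw [← tsum_ite_eq (0 : ℕ) (fun _ => (1 : ℂ))]
  refine tendsto_tsum_of_dominated_convergence hs (fun k => ?_) ?_
  · have := (tendsto_inv_eval_ascPochhammer_add_natCast c k).const_mul
      ((ascPochhammer ℂ k).eval a * (ascPochhammer ℂ k).eval b / k.factorial)
    convert this using 2 with n
    · simp only [hyp2F1Coeff, div_eq_mul_inv, mul_inv]
      ring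
    · by_cases hk : k = 0 <;> simp [hk]
  · have : Tendsto (fun n : ℕ => c.re + n) atTop atTop :=
      tendsto_atTop_add_const_left _ _ tendsto_natCast_atTop_atTop
    filter_upwards [this.eventually_ge_atTop r] with n hn k
    exact norm_hyp2F1Coeff_le hr (by simpa using hn) k

theorem ne_neg_natCast_of_re_pos {s : ℂ} (hs : 0 < s.re) (n : ℕ) : s ≠ -(n : ℂ) := by
  rintro rfl
  simp at hs
  linarith [(Nat.cast_nonneg n : (0 : ℝ) ≤ n)]

theorem gauss_summation (α β γ : ℂ) (h : 0 < (γ - α - β).re)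
    (hγ : ∀ n : ℕ, γ ≠ -(n : ℂ)) :
    hyp2F1C α β γ 1 =
      Complex.Gamma γ * Complex.Gamma (γ - α - β) /
        (Complex.Gamma (γ - α) * Complex.Gamma (γ - β)) := by
  have hδ := ne_neg_natCast_of_re_pos h
  have hF := ((tendsto_inv_GammaSeq (γ - α)).mul (tendsto_inv_GammaSeq (γ - β))).mul
    ((tendsto_hyp2F1C_one_add_natCast α β γ).comp (tendsto_add_atTop_nat 1))
  have hG := ((tendsto_inv_GammaSeq γ).mul (tendsto_inv_GammaSeq (γ - α - β))).mul_const
    (hyp2F1C α β γ 1)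
  have key := tendsto_nhds_unique_of_eventuallyEq hG hF ?_
  · have h1 := Gamma_ne_zero hγ
    have h2 := Gamma_ne_zero hδ
    rw [div_eq_mul_inv, mul_inv, ← mul_one ((Gamma (γ - α))⁻¹ * _), ← key]
    field_simp
  · filter_upwards [eventually_ne_atTop 0] with n hn
    have hn' : (n : ℂ) ≠ 0 := by exact_mod_cast hn
    have hpow : (n : ℂ) ^ γ * (n : ℂ) ^ (γ - α - β) = (n : ℂ) ^ (γ - α) * (n : ℂ) ^ (γ - β) := by
      rw [← cpow_add _ _ hn', ← cpow_add _ _ hn']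
      ring_nf
    have hne : (n : ℂ) ^ (γ - α) * (n : ℂ) ^ (γ - β) * (n.factorial : ℂ) ^ 2 ≠ 0 := by
      simp [cpow_eq_zero_iff, hn, n.factorial_ne_zero]
    have := hyp2F1C_one_mul_ascPochhammer h hγ (n + 1)
    simp only [eval_ascPochhammer_succ_eq_GammaSeq _ hn] at this
    refine mul_left_cancel₀ hne ?_
    simp only [Function.comp]
    linear_combination this - (n.factorial : ℂ) ^ 2 * (GammaSeq γ n)⁻¹ *
      (GammaSeq (γ - α - β) n)⁻¹ * hyp2F1C α β γ 1 * hpow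
end
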